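/- arXiv:1107.0235 — 2 statements merged into one kernel-verified Lean document; each statement's English description precedes it below -/
import Mathlib

section
/- Let (G,f,ν) be a chain graph with G connected and ν a deformable connection such that every vertex v has rank r(v) = Σ_{w∈V} ν(w,v)² equal to a fixed r > 0. Then every homology group H_k and every cohomology group H^k of the associated complexes is a finite abelian group, and H^k ≅ H_{k−1} for all k ∈ ℤ. -/
/-- A gradation on a simple graph: adjacent vertices have values differing by ±1. -/
def IsGradation {V : Type*} (G : SimpleGraph V) (f : V → ℤ) : Prop :=
  ∀ ⦃a b : V⦄, G.Adj a b → f a - f b = 1 ∨ f a - f b = -1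

/-- A connection on a graph: a symmetric integer function nonzero exactly on edges. -/
def IsConnection {V : Type*} (G : SimpleGraph V) (ν : V → V → ℤ) : Prop :=
  (∀ a b : V, ν a b = ν b a) ∧ ∀ a b : V, ν a b ≠ 0 ↔ G.Adj a b

/-- A deformable connection: `∑_c ν a c * ν c b = 0` for all vertices at distance 2. -/
def IsDeformable {V : Type*} [Fintype V] (G : SimpleGraph V) (ν : V → V → ℤ) : Prop :=
  ∀ a b : V, G.dist a b = 2 → (∑ c : V, ν a c * ν c b) = 0

/-- A chain graph: a gradation together with a connection satisfying the chain condition. -/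
def IsChainGraph {V : Type*} [Fintype V] (G : SimpleGraph V) (f : V → ℤ)
    (ν : V → V → ℤ) : Prop :=
  IsGradation G f ∧ IsConnection G ν ∧
    ∀ a b : V, f b = f a + 2 →
      (∑ c : V, if f c = f a + 1 then ν a c * ν c b else 0) = 0

/-- The linear map from the free abelian group on the level-`j` vertices to the free
abelian group on the level-`k` vertices, sending a vertex `v` to `∑_w ν v w • w`. -/
noncomputable def dmap {V : Type*} [Fintype V] [DecidableEq V]
    (f : V → ℤ) (ν : V → V → ℤ) (j k : ℤ) :
    ({v : V // f v = j} → ℤ) →ₗ[ℤ] ({v : V // f v = k} → ℤ) :=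
  Matrix.toLin' (Matrix.of fun (w : {v : V // f v = k}) (v : {v : V // f v = j}) => ν v.1 w.1)

/-- The `k`-th homology group of the chain complex associated to `(f, ν)`. -/
noncomputable abbrev Hk {V : Type*} [Fintype V] [DecidableEq V]
    (f : V → ℤ) (ν : V → V → ℤ) (k : ℤ) :=
  LinearMap.ker (dmap f ν k (k - 1)) ⧸
    ((LinearMap.range (dmap f ν (k + 1) k)).comap
      (LinearMap.ker (dmap f ν k (k - 1))).subtype)

/-- The `k`-th cohomology group of the cochain complex associated to `(f, ν)`. -/
noncomputable abbrev coHk {V : Type*} [Fintype V] [DecidableEq V]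
    (f : V → ℤ) (ν : V → V → ℤ) (k : ℤ) :=
  LinearMap.ker (dmap f ν k (k + 1)) ⧸
    ((LinearMap.range (dmap f ν (k - 1) k)).comap
      (LinearMap.ker (dmap f ν k (k + 1))).subtype)

/-- If `G` pairs injectively into the dual of a finite group `H`, then `G` embeds into `H`. -/
theorem exists_injective_of_injective_pairing {G H : Type*} [AddCommGroup G] [AddCommGroup H]
    [Finite H] (n : ℕ) [NeZero n] (β : G →ₗ[ℤ] H →ₗ[ℤ] ZMod n) (hβ : Function.Injective β) :
    ∃ φ : G →+ H, Function.Injective φ := by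
  obtain ⟨e⟩ := CommGroup.monoidHom_mulEquiv_of_hasEnoughRootsOfUnity (Multiplicative H) Circle
  let χ : Multiplicative (ZMod n) →* Circleˣ :=
    (toUnits (G := Circle)).toMonoidHom.comp (ZMod.toCircle (N := n)).toMonoidHom
  have hχ : Function.Injective χ :=
    (toUnits (G := Circle)).injective.comp (ZMod.injective_toCircle (N := n))
  let F : Multiplicative G →* (Multiplicative H →* Circleˣ) :=
    { toFun := fun g => χ.comp (AddMonoidHom.toMultiplicative (β g.toAdd).toAddMonoidHom)
      map_one' := by ext; simp
      map_mul' := fun x y => by ext; simp }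
  have hF : Function.Injective F := by
    intro x y hxy
    apply Multiplicative.toAdd.injective
    apply hβ
    ext h
    exact hχ (DFunLike.congr_fun hxy (Multiplicative.ofAdd h))
  exact ⟨AddMonoidHom.toMultiplicative.symm (e.toMonoidHom.comp F), e.injective.comp hF⟩

/-- Two finite abelian groups with a pairing that is nondegenerate on both sides are isomorphic. -/
theorem nonempty_linearEquiv_of_injective_pairing {G H : Type*} [AddCommGroup G]
    [AddCommGroup H] [Finite G] [Finite H] (n : ℕ) [NeZero n] (β : G →ₗ[ℤ] H →ₗ[ℤ] ZMod n)
    (hβ : Function.Injective β) (hβ' : Function.Injective β.flip) : Nonempty (G ≃ₗ[ℤ] H) := by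
  obtain ⟨φ, hφ⟩ := exists_injective_of_injective_pairing n β hβ
  obtain ⟨ψ, hψ⟩ := exists_injective_of_injective_pairing n β.flip hβ'
  have hcard : Nat.card G = Nat.card H :=
    le_antisymm (Nat.card_le_card_of_injective φ hφ) (Nat.card_le_card_of_injective ψ hψ)
  exact ⟨(AddEquiv.ofBijective φ
    ((Nat.bijective_iff_injective_and_card φ).2 ⟨hφ, hcard⟩)).toIntLinearEquiv⟩

/-- Over `ℤ`, a linear functional on the kernel of a map into a finite free module extends
to the whole source. -/
theorem exists_extend_ker {M N : Type*} [AddCommGroup M] [AddCommGroup N] [Module.Free ℤ N]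
    [Module.Finite ℤ N] (a : M →ₗ[ℤ] N) (φ : LinearMap.ker a →ₗ[ℤ] ℤ) :
    ∃ ψ : M →ₗ[ℤ] ℤ, ∀ y : LinearMap.ker a, ψ y = φ y := by
  obtain ⟨s, hs⟩ := Module.projective_lifting_property a.rangeRestrict LinearMap.id
    a.surjective_rangeRestrict
  have hs' : ∀ z, a (s z) = z := fun z => congrArg Subtype.val (LinearMap.congr_fun hs z)
  let p : M →ₗ[ℤ] LinearMap.ker a :=
    (LinearMap.id - s ∘ₗ a.rangeRestrict).codRestrict (LinearMap.ker a) fun x => by simp [hs']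
  refine ⟨φ ∘ₗ p, fun y => congrArg φ (Subtype.ext ?_)⟩
  have : a.rangeRestrict y = 0 := Subtype.ext y.2
  simp [p, this]

section LinkingForm

variable {P Q R S : Type*} [Fintype Q] [Fintype R] [Finite P]

/-- An element `x` with `r • x = b' (b x)` that links trivially with `ker a` is in the image of
`b'`. -/
theorem mem_range_of_forall_dvd {a : (Q → ℤ) →ₗ[ℤ] (P → ℤ)}
    {b : (R → ℤ) →ₗ[ℤ] (Q → ℤ)} {b' : (Q → ℤ) →ₗ[ℤ] (R → ℤ)}
    (hadj : ∀ x y, b x ⬝ᵥ y = x ⬝ᵥ b' y) (hab : ∀ x, a (b x) = 0) {r : ℤ} (hr : r ≠ 0)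
    {x : R → ℤ} (hx : r • x = b' (b x)) (h : ∀ y, a y = 0 → r ∣ b x ⬝ᵥ y) :
    x ∈ LinearMap.range b' := by
  classical
  choose g hg using fun y : LinearMap.ker a => h y y.2
  let φ : LinearMap.ker a →ₗ[ℤ] ℤ := (AddMonoidHom.mk' g fun y z => by
    apply mul_left_cancel₀ hr
    rw [← hg, mul_add, ← hg, ← hg]
    simp [dotProduct_add]).toIntLinearMap
  obtain ⟨ψ, hψ⟩ := exists_extend_ker a φ
  let w : Q → ℤ := fun i => ψ fun j => if i = j then 1 else 0
  have hw : ∀ y, w ⬝ᵥ y = ψ y := fun y => by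
    rw [ψ.pi_apply_eq_sum_univ y]
    simp [w, dotProduct, mul_comm]
  refine ⟨w, smul_right_injective (R → ℤ) hr ?_⟩
  change r • b' w = r • x
  rw [hx, ← map_smul]
  refine dotProduct_eq _ _ fun z => ?_
  rw [dotProduct_comm, ← hadj, dotProduct_comm (b' _), ← hadj, dotProduct_comm (b z),
    dotProduct_comm (b z), smul_dotProduct, hw]
  exact (congrArg (r • ·) (hψ ⟨b z, hab z⟩)).trans (hg ⟨b z, hab z⟩).symm

/-- The linking form induces an isomorphism between the cohomology and homology groups of
a piece of a complex with a scalar Laplacian. -/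
theorem nonempty_linearEquiv_of_linking [Finite S] {a : (Q → ℤ) →ₗ[ℤ] (P → ℤ)}
    {b : (R → ℤ) →ₗ[ℤ] (Q → ℤ)} {b' : (Q → ℤ) →ₗ[ℤ] (R → ℤ)} {c : (R → ℤ) →ₗ[ℤ] (S → ℤ)}
    (hadj : ∀ x y, b x ⬝ᵥ y = x ⬝ᵥ b' y) (hab : ∀ x, a (b x) = 0) (hcb : ∀ y, c (b' y) = 0)
    (r : ℕ) (hr : r ≠ 0) (hc : ∀ x, c x = 0 → (r : ℤ) • x = b' (b x))
    (ha : ∀ y, a y = 0 → (r : ℤ) • y = b (b' y))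
    [Finite (LinearMap.ker c ⧸ (LinearMap.range b').comap (LinearMap.ker c).subtype)]
    [Finite (LinearMap.ker a ⧸ (LinearMap.range b).comap (LinearMap.ker a).subtype)] :
    Nonempty ((LinearMap.ker c ⧸ (LinearMap.range b').comap (LinearMap.ker c).subtype) ≃ₗ[ℤ]
      (LinearMap.ker a ⧸ (LinearMap.range b).comap (LinearMap.ker a).subtype)) := by
  have : NeZero r := ⟨hr⟩
  have hr' : (r : ℤ) ≠ 0 := by exact_mod_cast hr
  let L : LinearMap.ker c →ₗ[ℤ] LinearMap.ker a →ₗ[ℤ] ZMod r :=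
    LinearMap.mk₂ ℤ (fun x y => ((b x ⬝ᵥ (y : Q → ℤ) : ℤ) : ZMod r))
      (by intros; simp) (fun k x y => by simp [-zsmul_eq_mul, smul_dotProduct]; simp)
      (by intros; simp) (fun k x y => by simp [-zsmul_eq_mul, dotProduct_smul]; simp)
  have hL : ∀ x y, L x y = ((b x ⬝ᵥ (y : Q → ℤ) : ℤ) : ZMod r) := fun _ _ => rfl
  have hL0 : ∀ x y, L x y = 0 ↔ (r : ℤ) ∣ b x ⬝ᵥ (y : Q → ℤ) := fun x y => by
    rw [hL, ZMod.intCast_zmod_eq_zero_iff_dvd]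
  have hleft : (LinearMap.range b').comap (LinearMap.ker c).subtype ≤ LinearMap.ker L := by
    rintro ⟨x, hx⟩ ⟨w, rfl⟩
    ext y
    rw [LinearMap.zero_apply, hL0]
    change (r : ℤ) ∣ b (b' w) ⬝ᵥ (y : Q → ℤ)
    rw [hadj, dotProduct_comm, ← hadj, ← ha y y.2, smul_dotProduct]
    exact dvd_mul_right _ _
  let β₁ := ((LinearMap.range b').comap (LinearMap.ker c).subtype).liftQ L hleft
  have hright : (LinearMap.range b).comap (LinearMap.ker a).subtype ≤ LinearMap.ker β₁.flip := by
    rintro ⟨y, hy⟩ ⟨u, rfl⟩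
    ext x
    change L x _ = 0
    rw [hL0]
    change (r : ℤ) ∣ b x ⬝ᵥ b u
    rw [dotProduct_comm, hadj, ← hc x x.2, dotProduct_smul]
    exact dvd_mul_right _ _
  let β₂ := ((LinearMap.range b).comap (LinearMap.ker a).subtype).liftQ β₁.flip hright
  have hβ : ∀ x y, β₂ (Submodule.Quotient.mk y) (Submodule.Quotient.mk x) = L x y :=
    fun _ _ => rfl
  refine nonempty_linearEquiv_of_injective_pairing r β₂.flip ?_ ?_
  · rw [injective_iff_map_eq_zero]
    intro q hq
    obtain ⟨x, rfl⟩ := Submodule.Quotient.mk_surjective _ q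
    rw [Submodule.Quotient.mk_eq_zero]
    refine mem_range_of_forall_dvd hadj hab hr' (hc x x.2) fun y hy => ?_
    exact (hL0 x ⟨y, hy⟩).1 (LinearMap.congr_fun hq (Submodule.Quotient.mk ⟨y, hy⟩))
  · rw [injective_iff_map_eq_zero]
    intro q hq
    obtain ⟨y, rfl⟩ := Submodule.Quotient.mk_surjective _ q
    rw [Submodule.Quotient.mk_eq_zero]
    refine mem_range_of_forall_dvd (fun u v => ?_) hcb hr' (ha y y.2) fun x hx => ?_
    · rw [dotProduct_comm, ← hadj, dotProduct_comm]
    · rw [dotProduct_comm, ← hadj]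
      exact (hL0 ⟨x, hx⟩ y).1 (LinearMap.congr_fun hq (Submodule.Quotient.mk ⟨x, hx⟩))

end LinkingForm

/-- A homology group of finitely generated abelian groups annihilated by `r ≠ 0` is finite. -/
theorem finite_homology_of_smul_mem {L M N : Type*} [AddCommGroup L] [AddCommGroup M]
    [AddCommGroup N] [Module.Finite ℤ M] (a : L →ₗ[ℤ] M) (b : M →ₗ[ℤ] N) {r : ℤ} (hr : r ≠ 0)
    (h : ∀ x, b x = 0 → r • x ∈ LinearMap.range a) :
    Finite (LinearMap.ker b ⧸ (LinearMap.range a).comap (LinearMap.ker b).subtype) := by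
  refine Module.finite_of_fg_torsion _ fun q => ?_
  obtain ⟨x, rfl⟩ := Submodule.Quotient.mk_surjective _ q
  refine ⟨⟨r, mem_nonZeroDivisors_of_ne_zero hr⟩, ?_⟩
  change Submodule.Quotient.mk (r • x) = _
  rw [Submodule.Quotient.mk_eq_zero]
  exact h x x.2

section ChainGraph

variable {V : Type*} [Fintype V] {G : SimpleGraph V} {f : V → ℤ} {ν : V → V → ℤ}

/-- The square of a deformable connection of constant rank `r` is `r` times the identity. -/
theorem sum_connection_mul_connection [DecidableEq V] (hgrad : IsGradation G f)
    (hν : IsConnection G ν) (hdef : IsDeformable G ν) (hconn : G.Connected) {r : ℤ}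
    (hrank : ∀ v : V, ∑ w : V, ν w v ^ 2 = r) (a b : V) :
    ∑ c : V, ν a c * ν c b = if a = b then r else 0 := by
  split_ifs with hab
  · subst hab
    rw [← hrank a]
    exact Finset.sum_congr rfl fun c _ => by rw [hν.1 a c, sq]
  · by_contra hne
    obtain ⟨c, -, hc⟩ := Finset.exists_ne_zero_of_sum_ne_zero hne
    have hac : G.Adj a c := (hν.2 a c).1 (left_ne_zero_of_mul hc)
    have hcb : G.Adj c b := (hν.2 c b).1 (right_ne_zero_of_mul hc)
    refine hne (hdef a b ?_)
    have hle : G.dist a b ≤ 2 := G.dist_le (.cons hac (.cons hcb .nil))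
    have h0 : G.dist a b ≠ 0 := fun h => hab (hconn.dist_eq_zero_iff.1 h)
    have h1 : G.dist a b ≠ 1 := fun h => by
      have h₁ := hgrad (SimpleGraph.dist_eq_one_iff_adj.1 h)
      have h₂ := hgrad hac
      have h₃ := hgrad hcb
      omega
    omega

theorem sum_level (k : ℤ) (g : V → ℤ) :
    ∑ c : {v : V // f v = k}, g c = ∑ c : V, if f c = k then g c else 0 := by
  rw [← Finset.sum_filter]
  exact (Finset.sum_subtype _ (by simp) g).symm

variable [DecidableEq V]

theorem dmap_adjoint (hν : IsConnection G ν) (j k : ℤ) (x : {v : V // f v = j} → ℤ)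
    (y : {v : V // f v = k} → ℤ) : dmap f ν j k x ⬝ᵥ y = x ⬝ᵥ dmap f ν k j y := by
  simp only [dmap, Matrix.toLin'_apply]
  rw [dotProduct_comm, Matrix.dotProduct_mulVec, ← Matrix.mulVec_transpose, dotProduct_comm]
  congr 2
  ext v w
  exact hν.1 _ _

theorem dmap_dmap (hchain : IsChainGraph G f ν) {j k l : ℤ}
    (h : k = j + 1 ∧ l = k + 1 ∨ k = l + 1 ∧ j = k + 1) (x : {v : V // f v = j} → ℤ) :
    dmap f ν k l (dmap f ν j k x) = 0 := by
  obtain ⟨-, hν, hc⟩ := hchain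
  simp only [dmap, Matrix.toLin'_apply, Matrix.mulVec_mulVec]
  refine (congrArg (Matrix.mulVec · x) ?_).trans (Matrix.zero_mulVec x)
  ext ⟨w, hw⟩ ⟨v, hv⟩
  rw [Matrix.mul_apply]
  simp only [Matrix.of_apply, Matrix.zero_apply]
  rw [sum_level k fun c => ν c w * ν v c]
  rcases h with ⟨h₁, h₂⟩ | ⟨h₁, h₂⟩
  · refine (Finset.sum_congr rfl fun c _ => ?_).trans (hc v w (by omega))
    rw [mul_comm, h₁, hv]
  · refine (Finset.sum_congr rfl fun c _ => ?_).trans (hc w v (by omega))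
    rw [hν.1 c w, hν.1 v c, h₁, hw]

theorem dmap_laplacian (hgrad : IsGradation G f) (hν : IsConnection G ν)
    (hdef : IsDeformable G ν) (hconn : G.Connected) {r : ℤ}
    (hrank : ∀ v : V, ∑ w : V, ν w v ^ 2 = r) (k : ℤ) (x : {v : V // f v = k} → ℤ) :
    r • x = dmap f ν (k - 1) k (dmap f ν k (k - 1) x) +
      dmap f ν (k + 1) k (dmap f ν k (k + 1) x) := by
  simp only [dmap, Matrix.toLin'_apply, Matrix.mulVec_mulVec]
  rw [← Matrix.add_mulVec]
  conv_lhs => rw [← Matrix.one_mulVec x, ← Matrix.smul_mulVec]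
  congr 1
  ext ⟨w, hw⟩ ⟨v, hv⟩
  rw [Matrix.add_apply, Matrix.mul_apply, Matrix.mul_apply]
  simp only [Matrix.of_apply]
  rw [sum_level (k - 1) fun c => ν c w * ν v c, sum_level (k + 1) fun c => ν c w * ν v c,
    ← Finset.sum_add_distrib]
  have hsq := sum_connection_mul_connection hgrad hν hdef hconn hrank w v
  trans ∑ c : V, ν w c * ν c v
  · rw [hsq]
    simp [Matrix.one_apply]
  · refine Finset.sum_congr rfl fun c _ => ?_
    rw [hν.1 w c, hν.1 c v]
    by_cases hc : ν v c = 0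
    · simp [hc]
    · have := hgrad ((hν.2 v c).1 hc)
      split_ifs <;> omega

end ChainGraph

/-- For a connected deformable chain graph of rank `r > 0`, all homology and cohomology
groups are finite (torsion) and `H^k ≅ H_{k-1}` for all `k`. -/
theorem homology_torsion_and_duality
    {V : Type*} [Fintype V] [DecidableEq V] (G : SimpleGraph V)
    (f : V → ℤ) (ν : V → V → ℤ)
    (hchain : IsChainGraph G f ν) (hdef : IsDeformable G ν) (hconn : G.Connected)
    (r : ℕ) (hr : 0 < r) (hrank : ∀ v : V, (∑ w : V, ν w v ^ 2) = (r : ℤ)) :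
    (∀ k : ℤ, Finite (Hk f ν k)) ∧ (∀ k : ℤ, Finite (coHk f ν k)) ∧
      ∀ k : ℤ, Nonempty (coHk f ν k ≃ₗ[ℤ] Hk f ν (k - 1)) := by
  obtain ⟨hgrad, hν, -⟩ := id hchain
  have hr0 : (r : ℤ) ≠ 0 := by exact_mod_cast hr.ne'
  have hlap := dmap_laplacian hgrad hν hdef hconn hrank
  have hdown : ∀ (k : ℤ) (x : {v : V // f v = k} → ℤ), dmap f ν k (k - 1) x = 0 →
      (r : ℤ) • x = dmap f ν (k + 1) k (dmap f ν k (k + 1) x) := fun k x hx => by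
    rw [hlap k x, hx, map_zero, zero_add]
  have hup : ∀ (k : ℤ) (x : {v : V // f v = k} → ℤ), dmap f ν k (k + 1) x = 0 →
      (r : ℤ) • x = dmap f ν (k - 1) k (dmap f ν k (k - 1) x) := fun k x hx => by
    rw [hlap k x, hx, map_zero, add_zero]
  have hH : ∀ k : ℤ, Finite (Hk f ν k) := fun k =>
    finite_homology_of_smul_mem _ _ hr0 fun x hx => ⟨_, (hdown k x hx).symm⟩
  have hcoH : ∀ k : ℤ, Finite (coHk f ν k) := fun k =>
    finite_homology_of_smul_mem _ _ hr0 fun x hx => ⟨_, (hup k x hx).symm⟩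
  refine ⟨hH, hcoH, fun k => ?_⟩
  have := hcoH k
  have := hH (k - 1)
  have hdown' := hdown (k - 1)
  unfold Hk at *
  rw [sub_add_cancel] at *
  exact nonempty_linearEquiv_of_linking (dmap_adjoint hν k (k - 1))
    (dmap_dmap hchain (by omega)) (dmap_dmap hchain (by omega)) r hr.ne' (hup k) hdown'
end

section
/- For every n ≥ 1, the graph G_n of strictly upper triangular 0-1 arrays is a diamond graph: whenever a, b, c ∈ G_n with a ≠ c, a adjacent to b, and b adjacent to c, there exists exactly one array d ∉ {a,b,c} adjacent to both a and c, such that a is not adjacent to c and b is not adjacent to d. -/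
/-- `UT n`: strictly upper triangular 0-1 arrays `(a_{i,j})_{0 ≤ i < j ≤ n}`,
encoded as functions on `Fin (n+1) × Fin (n+1)` vanishing off the region `i < j`. -/
def UT (n : ℕ) : Type :=
  {a : Fin (n + 1) → Fin (n + 1) → ℤ //
    ∀ i j : Fin (n + 1), (i < j → a i j = 0 ∨ a i j = 1) ∧ (¬ i < j → a i j = 0)}

/-- Adjacency in `G_n`: `a` and `b` differ exactly on a triple of positions
`(i,j), (j,l), (i,l)` with `i < j < l`, where one of them has entries `1, 1, 0` and
the other `0, 0, 1`. -/
def UTAdj {n : ℕ} (a b : UT n) : Prop :=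
  ∃ i j l : Fin (n + 1), i < j ∧ j < l ∧
    ((a.1 i j = 1 ∧ a.1 j l = 1 ∧ a.1 i l = 0 ∧
        b.1 i j = 0 ∧ b.1 j l = 0 ∧ b.1 i l = 1) ∨
      (b.1 i j = 1 ∧ b.1 j l = 1 ∧ b.1 i l = 0 ∧
        a.1 i j = 0 ∧ a.1 j l = 0 ∧ a.1 i l = 1)) ∧
    ∀ s t : Fin (n + 1),
      ¬ ((s = i ∧ t = j) ∨ (s = j ∧ t = l) ∨ (s = i ∧ t = l)) → a.1 s t = b.1 s t

/-- The weight of an array: `w_s(a) = ∑_{k<s} (1 - a_{k,s}) + ∑_{k>s} a_{s,k}`. -/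
def UTweight {n : ℕ} (a : UT n) : Fin (n + 1) → ℤ := fun s =>
  (∑ k : Fin (n + 1), if k < s then 1 - a.1 k s else 0) +
    ∑ k : Fin (n + 1), if s < k then a.1 s k else 0

namespace UT

variable {m n : ℕ}

/-- `a` and `b` differ by the exchange move on the triangle `i < j < l`. -/
def Move (i j l : Fin (n + 1)) (a b : UT n) : Prop :=
  i < j ∧ j < l ∧
    ((a.1 i j = 1 ∧ a.1 j l = 1 ∧ a.1 i l = 0 ∧
        b.1 i j = 0 ∧ b.1 j l = 0 ∧ b.1 i l = 1) ∨
      (b.1 i j = 1 ∧ b.1 j l = 1 ∧ b.1 i l = 0 ∧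
        a.1 i j = 0 ∧ a.1 j l = 0 ∧ a.1 i l = 1)) ∧
    ∀ s t : Fin (n + 1),
      ¬ ((s = i ∧ t = j) ∨ (s = j ∧ t = l) ∨ (s = i ∧ t = l)) → a.1 s t = b.1 s t

/-- `(s, t)` is an edge of the triangle `i < j < l`. -/
def Edge (i j l s t : Fin (n + 1)) : Prop :=
  (s = i ∧ t = j) ∨ (s = j ∧ t = l) ∨ (s = i ∧ t = l)

theorem ext' {a b : UT n} (h : ∀ s t, a.1 s t = b.1 s t) : a = b :=
  Subtype.ext (funext fun s => funext fun t => h s t)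

theorem Move.symm {i j l : Fin (n + 1)} {a b : UT n} (h : Move i j l a b) : Move i j l b a :=
  ⟨h.1, h.2.1, h.2.2.1.symm, fun s t hst => (h.2.2.2 s t hst).symm⟩

theorem Move.eq_off {i j l s t : Fin (n + 1)} {a b : UT n} (h : Move i j l a b)
    (hst : ¬ Edge i j l s t) : a.1 s t = b.1 s t :=
  h.2.2.2 s t hst

theorem Move.ne_on {i j l s t : Fin (n + 1)} {a b : UT n} (h : Move i j l a b)
    (hst : Edge i j l s t) : a.1 s t ≠ b.1 s t := by
  obtain ⟨-, -, h, -⟩ := h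
  rcases hst with ⟨rfl, rfl⟩ | ⟨rfl, rfl⟩ | ⟨rfl, rfl⟩ <;> rcases h with h | h <;>
    simp [h]

theorem Move.unique {i j l : Fin (n + 1)} {x a c : UT n} (ha : Move i j l x a)
    (hc : Move i j l x c) : a = c := by
  refine ext' fun s t => ?_
  by_cases hst : Edge i j l s t
  · have h₁ := ha.2.2.1
    have h₂ := hc.2.2.1
    rcases hst with ⟨rfl, rfl⟩ | ⟨rfl, rfl⟩ | ⟨rfl, rfl⟩ <;> omega
  · rw [← ha.eq_off hst, hc.eq_off hst]

/-- The sum of all entries; adjacent arrays have totals differing by one. -/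
def total (a : UT n) : ℤ := ∑ s, ∑ t, a.1 s t

theorem total_of_adj {a b : UT n} (h : UTAdj a b) :
    total b = total a + 1 ∨ total a = total b + 1 := by
  obtain ⟨i, j, l, hij, hjl, h, hoff⟩ := h
  obtain ⟨e, he, hdiff⟩ : ∃ e : ℤ, (e = 1 ∨ e = -1) ∧ ∀ s t, b.1 s t - a.1 s t =
      e * ((if s = i then if t = j then 1 else 0 else 0) +
        (if s = j then if t = l then 1 else 0 else 0) -
        (if s = i then if t = l then 1 else 0 else 0)) := by
    rcases h with h | h
    · refine ⟨-1, Or.inr rfl, fun s t => ?_⟩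
      have := hoff s t
      grind
    · refine ⟨1, Or.inl rfl, fun s t => ?_⟩
      have := hoff s t
      grind
  have key : total b - total a = e := by
    unfold total
    simp only [← Finset.sum_sub_distrib, hdiff, ← Finset.mul_sum]
    simp only [Finset.sum_sub_distrib, Finset.sum_add_distrib]
    have hs : ∀ p q : Fin (n + 1),
        (∑ s, ∑ t, (if s = p then if t = q then (1 : ℤ) else 0 else 0)) = 1 := by
      intro p q
      rw [Finset.sum_eq_single p] <;> simp +contextual
    simp only [hs]
    ring
  omega

/-- Two triangles through the same pair of distinct edges coincide. -/
theorem triangle_eq_of_edges {i j l i' j' l' s t u v : Fin (n + 1)} (hij : i < j) (hjl : j < l)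
    (hij' : i' < j') (hjl' : j' < l') (h₁ : Edge i j l s t) (h₂ : Edge i j l u v)
    (h₁' : Edge i' j' l' s t) (h₂' : Edge i' j' l' u v) (hne : s = u → t ≠ v) :
    i = i' ∧ j = j' ∧ l = l' := by
  unfold Edge at *
  grind

/-- Paths along two edge-disjoint triangles complete by exchanging the two moves. -/
theorem exists_unique_of_edge_disjoint {i j l i' j' l' : Fin (n + 1)} {a b c : UT n}
    (hab : Move i j l a b) (hbc : Move i' j' l' b c)
    (hdis : ∀ s t, Edge i j l s t → ¬ Edge i' j' l' s t) :
    ∃ d : UT n, d ≠ b ∧ UTAdj d a ∧ UTAdj d c ∧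
      ∀ d', d' ≠ b → UTAdj d' a → UTAdj d' c → d' = d := by
  have hcase : ∀ s t, a.1 s t = b.1 s t ∨ b.1 s t = c.1 s t := fun s t => by
    by_cases h : Edge i j l s t
    · exact Or.inr (hbc.eq_off (hdis s t h))
    · exact Or.inl (hab.eq_off h)
  let d : UT n := ⟨fun s t => a.1 s t + c.1 s t - b.1 s t, fun s t => by
    have h₁ := a.2 s t
    have h₂ := c.2 s t
    rcases hcase s t with h | h
    · simpa [h] using h₂
    · simpa [h] using h₁⟩
  have hd₁ : ∀ s t, Edge i j l s t → d.1 s t = a.1 s t := fun s t h => by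
    simp [d, hbc.eq_off (hdis s t h)]
  have hd₂ : ∀ s t, ¬ Edge i j l s t → d.1 s t = c.1 s t := fun s t h => by
    simp [d, hab.eq_off h]
  have hdc : Move i j l d c := by
    refine ⟨hab.1, hab.2.1, ?_, hd₂⟩
    have e₁ : Edge i j l i j := Or.inl ⟨rfl, rfl⟩
    have e₂ : Edge i j l j l := Or.inr (Or.inl ⟨rfl, rfl⟩)
    have e₃ : Edge i j l i l := Or.inr (Or.inr ⟨rfl, rfl⟩)
    rw [hd₁ _ _ e₁, hd₁ _ _ e₂, hd₁ _ _ e₃, ← hbc.eq_off (hdis _ _ e₁),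
      ← hbc.eq_off (hdis _ _ e₂), ← hbc.eq_off (hdis _ _ e₃)]
    exact hab.2.2.1
  have hd₃ : ∀ s t, Edge i' j' l' s t → a.1 s t = b.1 s t ∧ d.1 s t = c.1 s t := fun s t h =>
    have h' : ¬ Edge i j l s t := fun h' => hdis s t h' h
    ⟨hab.eq_off h', hd₂ s t h'⟩
  have had : Move i' j' l' a d := by
    refine ⟨hbc.1, hbc.2.1, ?_, fun s t h => by simp [d, hbc.eq_off h]⟩
    have e₁ := hd₃ i' j' (Or.inl ⟨rfl, rfl⟩)
    have e₂ := hd₃ j' l' (Or.inr (Or.inl ⟨rfl, rfl⟩))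
    have e₃ := hd₃ i' l' (Or.inr (Or.inr ⟨rfl, rfl⟩))
    rw [e₁.1, e₁.2, e₂.1, e₂.2, e₃.1, e₃.2]
    exact hbc.2.2.1
  refine ⟨d, ?_, ⟨i', j', l', had.symm⟩, ⟨i, j, l, hdc⟩, ?_⟩
  · intro h
    have e : Edge i' j' l' i' j' := Or.inl ⟨rfl, rfl⟩
    exact hbc.ne_on e (h ▸ (hd₃ i' j' e).2)
  · rintro d' hne ⟨p, q, r, hda⟩ ⟨p', q', r', hdc'⟩
    change Move p q r d' a at hda
    change Move p' q' r' d' c at hdc'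
    have hcov : ∀ s t, Edge i j l s t → Edge p q r s t ∨ Edge p' q' r' s t := fun s t h => by
      by_contra! hn
      exact hab.ne_on h
        ((hda.eq_off hn.1).symm.trans ((hdc'.eq_off hn.2).trans (hbc.eq_off (hdis s t h)).symm))
    have hor : (i = p ∧ j = q ∧ l = r) ∨ (i = p' ∧ j = q' ∧ l = r') := by
      have hij := hab.1
      have hjl := hab.2.1
      have e₁ : Edge i j l i j := Or.inl ⟨rfl, rfl⟩
      have e₂ : Edge i j l j l := Or.inr (Or.inl ⟨rfl, rfl⟩)
      have e₃ : Edge i j l i l := Or.inr (Or.inr ⟨rfl, rfl⟩)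
      have n₁₂ : i = j → j ≠ l := fun h => absurd h hij.ne
      have n₁₃ : i = i → j ≠ l := fun _ => hjl.ne
      have n₂₃ : j = i → l ≠ l := fun h => absurd h hij.ne'
      have T := @triangle_eq_of_edges n i j l p q r
      have T' := @triangle_eq_of_edges n i j l p' q' r'
      rcases hcov _ _ e₁ with h₁ | h₁ <;> rcases hcov _ _ e₂ with h₂ | h₂
      · exact Or.inl (T hij hjl hda.1 hda.2.1 e₁ e₂ h₁ h₂ n₁₂)
      · rcases hcov _ _ e₃ with h₃ | h₃
        · exact Or.inl (T hij hjl hda.1 hda.2.1 e₁ e₃ h₁ h₃ n₁₃)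
        · exact Or.inr (T' hij hjl hdc'.1 hdc'.2.1 e₂ e₃ h₂ h₃ n₂₃)
      · rcases hcov _ _ e₃ with h₃ | h₃
        · exact Or.inl (T hij hjl hda.1 hda.2.1 e₂ e₃ h₂ h₃ n₂₃)
        · exact Or.inr (T' hij hjl hdc'.1 hdc'.2.1 e₁ e₃ h₁ h₃ n₁₃)
      · exact Or.inr (T' hij hjl hdc'.1 hdc'.2.1 e₁ e₂ h₁ h₂ n₁₂)
    rcases hor with ⟨rfl, rfl, rfl⟩ | ⟨rfl, rfl, rfl⟩
    · exact absurd (hda.symm.unique hab) hne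
    · exact hdc'.symm.unique hdc.symm

/-- The array with the given entries in positions `01, 02, 03, 12, 13, 23`. -/
def ofBits (x : Bool × Bool × Bool × Bool × Bool × Bool) : UT 3 :=
  ⟨![![0, x.1.toInt, x.2.1.toInt, x.2.2.1.toInt],
    ![0, 0, x.2.2.2.1.toInt, x.2.2.2.2.1.toInt],
    ![0, 0, 0, x.2.2.2.2.2.toInt],
    ![0, 0, 0, 0]], by
    have h : ∀ p : Bool, p.toInt = 0 ∨ p.toInt = 1 := by decide
    intro s t
    fin_cases s <;> fin_cases t <;> simp [h]⟩

/-- Adjacency in `G_3` read off from the bit encoding. -/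
def BitAdj (x y : Bool × Bool × Bool × Bool × Bool × Bool) : Bool :=
  match x, y with
  | (a, b, c, d, e, f), (a', b', c', d', e', f') =>
    (a != a' && a == d && b == !a && a' == d' && b' == !a' && c == c' && e == e' && f == f') ||
    (a != a' && a == e && c == !a && a' == e' && c' == !a' && b == b' && d == d' && f == f') ||
    (b != b' && b == f && c == !b && b' == f' && c' == !b' && a == a' && d == d' && e == e') ||
    (d != d' && d == f && e == !d && d' == f' && e' == !d' && a == a' && b == b' && c == c')

theorem ofBits_surjective : Function.Surjective ofBits := by
  intro a
  have hb : ∀ s t, (decide (a.1 s t = 1)).toInt = a.1 s t := fun s t => by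
    have := a.2 s t
    by_cases hst : s < t
    · rcases this.1 hst with h | h <;> simp [h]
    · simp [this.2 hst]
  refine ⟨(decide (a.1 0 1 = 1), decide (a.1 0 2 = 1), decide (a.1 0 3 = 1),
    decide (a.1 1 2 = 1), decide (a.1 1 3 = 1), decide (a.1 2 3 = 1)), ext' fun s t => ?_⟩
  have h0 := (a.2 s t).2
  fin_cases s <;> fin_cases t <;>
    first
    | exact hb _ _
    | exact (h0 (by decide)).symm

theorem adj_ofBits (x y : Bool × Bool × Bool × Bool × Bool × Bool) :
    UTAdj (ofBits x) (ofBits y) ↔ BitAdj x y = true := by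
  have h1 : ∀ p : Bool, p.toInt = 1 ↔ p = true := by decide
  have h0 : ∀ p : Bool, p.toInt = 0 ↔ p = false := by decide
  have he : ∀ p q : Bool, p.toInt = q.toInt ↔ p = q := by decide
  obtain ⟨a, b, c, d, e, f⟩ := x
  obtain ⟨a', b', c', d', e', f'⟩ := y
  constructor
  · rintro ⟨i, j, l, hij, hjl, hp, hoff⟩
    have o₁ := hoff 0 1
    have o₂ := hoff 0 2
    have o₃ := hoff 0 3
    have o₄ := hoff 1 2
    have o₅ := hoff 1 3
    have o₆ := hoff 2 3
    clear hoff
    fin_cases i <;> fin_cases j <;> first | exact absurd hij (by decide) | skip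
    all_goals fin_cases l <;> first | exact absurd hjl (by decide) | skip
    all_goals
      simp [ofBits, h1, h0, he] at hp o₁ o₂ o₃ o₄ o₅ o₆
      simp only [BitAdj]
      rcases hp with hp | hp <;> simp [*]
  · intro h
    simp only [BitAdj, Bool.or_eq_true, Bool.and_eq_true, bne_iff_ne, beq_iff_eq] at h
    rcases h with ((h | h) | h) | h
    · refine ⟨0, 1, 2, by decide, by decide, ?_, ?_⟩
      · simp [ofBits, h1, h0]
        grind
      · simp [ofBits, he, Fin.forall_fin_succ, h]
    · refine ⟨0, 1, 3, by decide, by decide, ?_, ?_⟩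
      · simp [ofBits, h1, h0]
        grind
      · simp [ofBits, he, Fin.forall_fin_succ, h]
    · refine ⟨0, 2, 3, by decide, by decide, ?_, ?_⟩
      · simp [ofBits, h1, h0]
        grind
      · simp [ofBits, he, Fin.forall_fin_succ, h]
    · refine ⟨1, 2, 3, by decide, by decide, ?_, ?_⟩
      · simp [ofBits, h1, h0]
        grind
      · simp [ofBits, he, Fin.forall_fin_succ, h]

theorem ofBits_injective : Function.Injective ofBits := by
  have he : ∀ p q : Bool, p.toInt = q.toInt → p = q := by decide
  intro x y h
  have hv : ∀ s t, (ofBits x).1 s t = (ofBits y).1 s t := fun s t => by rw [h]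
  exact Prod.ext (he _ _ (hv 0 1)) (Prod.ext (he _ _ (hv 0 2)) (Prod.ext (he _ _ (hv 0 3))
    (Prod.ext (he _ _ (hv 1 2)) (Prod.ext (he _ _ (hv 1 3)) (he _ _ (hv 2 3))))))

set_option synthInstance.maxSize 4096 in
theorem exists_unique_bits : ∀ x y : Bool × Bool × Bool × Bool × Bool × Bool, BitAdj x y = true →
    ∀ z, BitAdj y z = true → x ≠ z → ∃ w, w ≠ y ∧ BitAdj w x = true ∧ BitAdj w z = true ∧
      ∀ w', w' ≠ y → BitAdj w' x = true → BitAdj w' z = true → w' = w := by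
  decide +kernel

theorem exists_unique_three {a b c : UT 3} (hac : a ≠ c) (hab : UTAdj a b) (hbc : UTAdj b c) :
    ∃ d : UT 3, d ≠ b ∧ UTAdj d a ∧ UTAdj d c ∧
      ∀ d', d' ≠ b → UTAdj d' a → UTAdj d' c → d' = d := by
  obtain ⟨x, rfl⟩ := ofBits_surjective a
  obtain ⟨y, rfl⟩ := ofBits_surjective b
  obtain ⟨z, rfl⟩ := ofBits_surjective c
  rw [adj_ofBits] at hab hbc
  obtain ⟨w, hwy, hwx, hwz, hw⟩ := exists_unique_bits x y hab z hbc (fun h => hac (h ▸ rfl))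
  refine ⟨ofBits w, ofBits_injective.ne hwy, (adj_ofBits _ _).2 hwx, (adj_ofBits _ _).2 hwz, ?_⟩
  intro d' hd hx hz
  obtain ⟨w', rfl⟩ := ofBits_surjective d'
  rw [adj_ofBits] at hx hz
  rw [hw w' (fun h => hd (h ▸ rfl)) hx hz]

/-- Restriction of an array to the vertices in the image of an order embedding. -/
def restrict (σ : Fin (m + 1) ↪o Fin (n + 1)) (a : UT n) : UT m :=
  ⟨fun s t => a.1 (σ s) (σ t), fun s t => by simpa using a.2 (σ s) (σ t)⟩

/-- Two arrays agree at all positions not between vertices in the image of `σ`. -/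
def AgreeOff (σ : Fin (m + 1) ↪o Fin (n + 1)) (a b : UT n) : Prop :=
  ∀ s t, ¬ (s ∈ Set.range σ ∧ t ∈ Set.range σ) → a.1 s t = b.1 s t

theorem eq_of_restrict_eq {σ : Fin (m + 1) ↪o Fin (n + 1)} {a b : UT n} (h : AgreeOff σ a b)
    (hr : restrict σ a = restrict σ b) : a = b := by
  refine ext' fun s t => ?_
  by_cases hst : s ∈ Set.range σ ∧ t ∈ Set.range σ
  · obtain ⟨⟨s, rfl⟩, ⟨t, rfl⟩⟩ := hst
    exact congrFun (congrFun (congrArg Subtype.val hr) s) t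
  · exact h s t hst

theorem adj_of_restrict {σ : Fin (m + 1) ↪o Fin (n + 1)} {a b : UT n} (h : AgreeOff σ a b)
    (hr : UTAdj (restrict σ a) (restrict σ b)) : UTAdj a b := by
  obtain ⟨i, j, l, hij, hjl, hp, hoff⟩ := hr
  refine ⟨σ i, σ j, σ l, by simpa, by simpa, hp, fun s t hst => ?_⟩
  by_cases hr : s ∈ Set.range σ ∧ t ∈ Set.range σ
  · obtain ⟨⟨s, rfl⟩, ⟨t, rfl⟩⟩ := hr
    exact hoff s t (by simpa using hst)
  · exact h s t hr

theorem Move.restrict {σ : Fin (m + 1) ↪o Fin (n + 1)} {i j l : Fin (n + 1)} {a b : UT n}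
    (h : Move i j l a b) (hi : i ∈ Set.range σ) (hj : j ∈ Set.range σ) (hl : l ∈ Set.range σ) :
    AgreeOff σ a b ∧ UTAdj (restrict σ a) (restrict σ b) := by
  obtain ⟨i, rfl⟩ := hi
  obtain ⟨j, rfl⟩ := hj
  obtain ⟨l, rfl⟩ := hl
  refine ⟨fun s t hst => h.eq_off ?_, i, j, l, by simpa using h.1, by simpa using h.2.1,
    h.2.2.1, fun s t hst => h.eq_off (by simpa [Edge] using hst)⟩
  rintro (⟨rfl, rfl⟩ | ⟨rfl, rfl⟩ | ⟨rfl, rfl⟩) <;> simp at hst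

theorem exists_restrict_eq (σ : Fin (m + 1) ↪o Fin (n + 1)) (a : UT n) (d : UT m) :
    ∃ b : UT n, AgreeOff σ b a ∧ restrict σ b = d := by
  classical
  let f : Fin (n + 1) → Fin (n + 1) → ℤ := fun s t =>
    if h : s ∈ Set.range σ ∧ t ∈ Set.range σ then d.1 h.1.choose h.2.choose else a.1 s t
  have hf : ∀ s t, f (σ s) (σ t) = d.1 s t := fun s t => by
    have h : σ s ∈ Set.range σ ∧ σ t ∈ Set.range σ := ⟨⟨s, rfl⟩, ⟨t, rfl⟩⟩
    have hs : h.1.choose = s := σ.injective h.1.choose_spec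
    have ht : h.2.choose = t := σ.injective h.2.choose_spec
    simp only [f, dif_pos h, hs, ht]
  have hf' : ∀ s t, ¬ (s ∈ Set.range σ ∧ t ∈ Set.range σ) → f s t = a.1 s t := fun s t h =>
    dif_neg h
  refine ⟨⟨f, fun s t => ?_⟩, hf', ext' hf⟩
  by_cases h : s ∈ Set.range σ ∧ t ∈ Set.range σ
  · obtain ⟨⟨s, rfl⟩, ⟨t, rfl⟩⟩ := h
    simpa [hf] using d.2 s t
  · simpa [hf' s t h] using a.2 s t

/-- A vertex of the first triangle of a path `a - d - c` lies on an edge where `a`, `c` differ. -/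
theorem Move.exists_ne_of_vertex {i j l i' j' l' u : Fin (n + 1)} {a c d : UT n} (hac : a ≠ c)
    (hda : Move i j l d a) (hdc : Move i' j' l' d c) (hu : u = i ∨ u = j ∨ u = l) :
    ∃ s t, (s = u ∨ t = u) ∧ a.1 s t ≠ c.1 s t := by
  by_contra! hn
  have hcov : ∀ s t, (s = u ∨ t = u) → Edge i j l s t → Edge i' j' l' s t := fun s t h he => by
    by_contra he'
    exact hda.ne_on he ((hdc.eq_off he').trans (hn s t h).symm)
  obtain ⟨rfl, rfl, rfl⟩ : i = i' ∧ j = j' ∧ l = l' := by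
    have h₁ := hda.1
    have h₂ := hda.2.1
    have h₁' := hdc.1
    have h₂' := hdc.2.1
    have e₁ := hcov i j
    have e₂ := hcov j l
    have e₃ := hcov i l
    unfold Edge at *
    grind
  exact hac (hda.unique hdc)

/-- Paths along two distinct triangles with a common edge complete inside the tetrahedron
they span. -/
theorem exists_unique_of_common_edge {i j l i' j' l' s t : Fin (n + 1)} {a b c : UT n}
    (hac : a ≠ c) (hab : Move i j l a b) (hbc : Move i' j' l' b c)
    (h₁ : Edge i j l s t) (h₂ : Edge i' j' l' s t) :
    ∃ d : UT n, d ≠ b ∧ UTAdj d a ∧ UTAdj d c ∧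
      ∀ d', d' ≠ b → UTAdj d' a → UTAdj d' c → d' = d := by
  have hT : ¬ (i = i' ∧ j = j' ∧ l = l') := by
    rintro ⟨rfl, rfl, rfl⟩
    exact hac (hab.symm.unique hbc)
  let S : Finset (Fin (n + 1)) := {i, j, l} ∪ {i', j', l'}
  have hS : S.card = 3 + 1 := by
    have hij := hab.1
    have hjl := hab.2.1
    have hij' := hbc.1
    have hjl' := hbc.2.1
    have hi : ({i, j, l} ∩ {i', j', l'} : Finset (Fin (n + 1))) = {s, t} := by
      unfold Edge at *
      ext u
      simp only [Finset.mem_inter, Finset.mem_insert, Finset.mem_singleton]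
      grind
    have hst : s ≠ t := by
      unfold Edge at *
      grind
    have c₁ : ({i, j, l} : Finset (Fin (n + 1))).card = 3 :=
      Finset.card_eq_three.2 ⟨i, j, l, hij.ne, (hij.trans hjl).ne, hjl.ne, rfl⟩
    have c₂ : ({i', j', l'} : Finset (Fin (n + 1))).card = 3 :=
      Finset.card_eq_three.2 ⟨i', j', l', hij'.ne, (hij'.trans hjl').ne, hjl'.ne, rfl⟩
    have := Finset.card_union_add_card_inter ({i, j, l} : Finset (Fin (n + 1))) {i', j', l'}
    rw [hi, c₁, c₂, Finset.card_pair hst] at this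
    change S.card + 2 = _ at this
    omega
  let σ : Fin (3 + 1) ↪o Fin (n + 1) := S.orderEmbOfFin hS
  have hσ : ∀ u, u ∈ S → u ∈ Set.range σ := fun u hu => by
    rw [Finset.range_orderEmbOfFin]
    exact hu
  obtain ⟨hoab, hrab⟩ := hab.restrict (σ := σ) (hσ _ (by simp [S])) (hσ _ (by simp [S]))
    (hσ _ (by simp [S]))
  obtain ⟨hobc, hrbc⟩ := hbc.restrict (σ := σ) (hσ _ (by simp [S])) (hσ _ (by simp [S]))
    (hσ _ (by simp [S]))
  have hoac : AgreeOff σ a c := fun s t h => (hoab s t h).trans (hobc s t h)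
  obtain ⟨e, heb, hea, hec, he⟩ :=
    exists_unique_three (fun h => hac (eq_of_restrict_eq hoac h)) hrab hrbc
  obtain ⟨d, hoda, rfl⟩ := exists_restrict_eq σ a e
  have hodc : AgreeOff σ d c := fun s t h => (hoda s t h).trans (hoac s t h)
  refine ⟨d, fun h => heb (h ▸ rfl), adj_of_restrict hoda hea, adj_of_restrict hodc hec, ?_⟩
  rintro d' hne ⟨p, q, r, hda⟩ ⟨p', q', r', hdc⟩
  change Move p q r d' a at hda
  change Move p' q' r' d' c at hdc
  have hv : ∀ u, (∃ s t, (s = u ∨ t = u) ∧ a.1 s t ≠ c.1 s t) → u ∈ Set.range σ := by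
    rintro u ⟨s, t, hu, hst⟩
    have := not_imp_comm.1 (hoac s t) hst
    rcases hu with rfl | rfl
    exacts [this.1, this.2]
  have hv₁ : ∀ u, (u = p ∨ u = q ∨ u = r) → u ∈ Set.range σ := fun u hu =>
    hv u (hda.exists_ne_of_vertex hac hdc hu)
  have hv₂ : ∀ u, (u = p' ∨ u = q' ∨ u = r') → u ∈ Set.range σ := fun u hu => by
    obtain ⟨s, t, h, h'⟩ := hdc.exists_ne_of_vertex hac.symm hda hu
    exact hv u ⟨s, t, h, h'.symm⟩
  obtain ⟨hod, hrd⟩ := hda.restrict (hv₁ p (by simp)) (hv₁ q (by simp)) (hv₁ r (by simp))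
  obtain ⟨-, hrd'⟩ := hdc.restrict (hv₂ p' (by simp)) (hv₂ q' (by simp)) (hv₂ r' (by simp))
  refine eq_of_restrict_eq (fun s t h => (hod s t h).trans (hoda s t h).symm) (he _ ?_ hrd hrd')
  exact fun h => hne (eq_of_restrict_eq (fun s t h => (hod s t h).trans (hoab s t h)) h)

theorem exists_unique_midpoint {a b c : UT n} (hac : a ≠ c) (hab : UTAdj a b) (hbc : UTAdj b c) :
    ∃ d : UT n, d ≠ b ∧ UTAdj d a ∧ UTAdj d c ∧
      ∀ d', d' ≠ b → UTAdj d' a → UTAdj d' c → d' = d := by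
  obtain ⟨i, j, l, hab⟩ := hab
  obtain ⟨i', j', l', hbc⟩ := hbc
  by_cases h : ∀ s t, Edge i j l s t → ¬ Edge i' j' l' s t
  · exact exists_unique_of_edge_disjoint hab hbc h
  · push Not at h
    obtain ⟨s, t, h₁, h₂⟩ := h
    exact exists_unique_of_common_edge hac hab hbc h₁ h₂

end UT

/-- `G_n` is a diamond graph: every path `a-b-c` with `a ≠ c` completes to a unique
diamond. -/
theorem UT_is_diamond_graph (n : ℕ) (hn : 1 ≤ n) (a b c : UT n)
    (hac : a ≠ c) (hab : UTAdj a b) (hbc : UTAdj b c) :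
    ∃! d : UT n, d ≠ a ∧ d ≠ b ∧ d ≠ c ∧ UTAdj d a ∧ UTAdj d c ∧
      ¬ UTAdj a c ∧ ¬ UTAdj b d := by
  obtain ⟨d, hdb, hda, hdc, hd⟩ := UT.exists_unique_midpoint hac hab hbc
  have tab := UT.total_of_adj hab
  have tbc := UT.total_of_adj hbc
  have tda := UT.total_of_adj hda
  have irrefl : ∀ x : UT n, ¬ UTAdj x x := fun x h => by
    have := UT.total_of_adj h
    omega
  refine ⟨d, ⟨?_, hdb, ?_, hda, hdc, ?_, ?_⟩, fun d' h => hd d' h.2.1 h.2.2.2.1 h.2.2.2.2.1⟩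
  · rintro rfl
    exact irrefl _ hda
  · rintro rfl
    exact irrefl _ hdc
  · intro h
    have := UT.total_of_adj h
    omega
  · intro h
    have := UT.total_of_adj h
    omega
end
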